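/- arXiv:2112.15013 — 5 statements merged into one kernel-verified Lean document; each statement's English description precedes it below -/
import Mathlib

section
/- Fix an integer ℓ ≥ 1, real numbers λ_1,…,λ_{ℓ+1}, and x ∈ ℝ. Then the function (0,∞)^ℓ → ℂ given by t ↦ (∏_{i=1}^{ℓ} t_i^{iλ_i−1} e^{−t_i}) · (e^x ∏_{i=1}^{ℓ} t_i^{−1})^{iλ_{ℓ+1}} · exp(−e^x ∏_{i=1}^{ℓ} t_i^{−1}) is Lebesgue-integrable on (0,∞)^ℓ. Consequently the mirror period Ψ(x) is well defined for every x ∈ ℝ. -/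
open MeasureTheory Complex

/-- The integrand of the mirror period for `ℙ^ℓ`, written with respect to Lebesgue
measure `dt_1 ⋯ dt_ℓ`: the factors `dt_i/t_i` are absorbed as `t_i^{iλ_i - 1}`,
and the delta constraint is solved by `t_{ℓ+1} = e^x ∏_{i=1}^ℓ t_i⁻¹`. -/
noncomputable def mirrorIntegrand (ℓ : ℕ) (lam : Fin (ℓ + 1) → ℝ) (x : ℝ)
    (t : Fin ℓ → ℝ) : ℂ :=
  (∏ i : Fin ℓ, ((t i : ℂ) ^ (Complex.I * (lam i.castSucc : ℂ) - 1)
      * Complex.exp (-(t i : ℂ))))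
    * ((Real.exp x * ∏ i : Fin ℓ, (t i)⁻¹ : ℝ) : ℂ) ^ (Complex.I * (lam (Fin.last ℓ) : ℂ))
    * Complex.exp (-((Real.exp x * ∏ i : Fin ℓ, (t i)⁻¹ : ℝ) : ℂ))

/-- For every `ℓ ≥ 1`, real `λ_1, …, λ_{ℓ+1}` and `x ∈ ℝ`, the function
`t ↦ (∏ t_i^{iλ_i - 1} e^{-t_i}) · (e^x ∏ t_i⁻¹)^{iλ_{ℓ+1}} · exp(-e^x ∏ t_i⁻¹)`
is Lebesgue-integrable on `(0,∞)^ℓ`; consequently the mirror period `Ψ(x)` is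
well defined for every `x`. -/
theorem mirrorIntegrand_integrableOn (ℓ : ℕ) (hℓ : 1 ≤ ℓ)
    (lam : Fin (ℓ + 1) → ℝ) (x : ℝ) :
    IntegrableOn (mirrorIntegrand ℓ lam x) {t : Fin ℓ → ℝ | ∀ i, 0 < t i} volume := by
  have hset : {t : Fin ℓ → ℝ | ∀ i, 0 < t i} = Set.univ.pi (fun _ => Set.Ioi (0 : ℝ)) := by
    ext t; simp
  have hmS : MeasurableSet {t : Fin ℓ → ℝ | ∀ i, 0 < t i} := by
    rw [hset]
    exact MeasurableSet.univ_pi (fun _ => measurableSet_Ioi)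
  have hdom : IntegrableOn (fun t : Fin ℓ → ℝ => Real.exp (-x) * ∏ i, Real.exp (-(t i)))
      {t : Fin ℓ → ℝ | ∀ i, 0 < t i} volume := by
    rw [hset, IntegrableOn, volume_pi, Measure.restrict_pi_pi]
    refine Integrable.const_mul ?_ _
    exact Integrable.fintype_prod (f := fun _ : Fin ℓ => fun s : ℝ => Real.exp (-s))
      (fun _ => integrableOn_exp_neg_Ioi 0)
  have hmeas : Measurable (mirrorIntegrand ℓ lam x) := by
    unfold mirrorIntegrand
    fun_prop
  refine Integrable.mono' hdom hmeas.aestronglyMeasurable ?_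
  filter_upwards [ae_restrict_mem hmS] with t ht
  have ht' : ∀ i, 0 < t i := ht
  have hP : 0 < ∏ i : Fin ℓ, (t i)⁻¹ := Finset.prod_pos (fun i _ => inv_pos.mpr (ht' i))
  have hy : 0 < Real.exp x * ∏ i : Fin ℓ, (t i)⁻¹ := mul_pos (Real.exp_pos x) hP
  have hnorm : ‖mirrorIntegrand ℓ lam x t‖ =
      (∏ i : Fin ℓ, (t i)⁻¹) * (∏ i : Fin ℓ, Real.exp (-(t i)))
        * Real.exp (-(Real.exp x * ∏ i : Fin ℓ, (t i)⁻¹)) := by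
    unfold mirrorIntegrand
    rw [norm_mul, norm_mul, norm_prod, Complex.norm_cpow_eq_rpow_re_of_pos hy, Complex.norm_exp,
      ← Finset.prod_mul_distrib]
    congr 1
    · have h1 : (Complex.I * (lam (Fin.last ℓ) : ℂ)).re = 0 := by simp
      rw [h1, Real.rpow_zero, mul_one]
      refine Finset.prod_congr rfl (fun i _ => ?_)
      have h2 : (Complex.I * (lam i.castSucc : ℂ) - 1).re = -1 := by simp
      rw [norm_mul, Complex.norm_cpow_eq_rpow_re_of_pos (ht' i), Complex.norm_exp, h2,
        Real.rpow_neg_one, Complex.neg_re, Complex.ofReal_re]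
  rw [hnorm]
  set P := ∏ i : Fin ℓ, (t i)⁻¹
  have hE : 0 ≤ ∏ i : Fin ℓ, Real.exp (-(t i)) := Finset.prod_nonneg (fun i _ => (Real.exp_pos _).le)
  have key : P * Real.exp (-(Real.exp x * P)) ≤ Real.exp (-x) := by
    have h3 : Real.exp x * P ≤ Real.exp (Real.exp x * P) := by
      linarith [Real.add_one_le_exp (Real.exp x * P)]
    rw [Real.exp_neg, Real.exp_neg, ← div_eq_mul_inv, div_le_iff₀ (Real.exp_pos _),
      inv_mul_eq_div, le_div_iff₀ (Real.exp_pos _), mul_comm]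
    exact h3
  calc _ = (P * Real.exp (-(Real.exp x * P))) * ∏ i : Fin ℓ, Real.exp (-(t i)) := by ring
    _ ≤ _ := mul_le_mul_of_nonneg_right key hE
end

section
/- Fix an integer ℓ ≥ 1 and real numbers λ_1,…,λ_{ℓ+1}, and let Ψ be the ℙ^ℓ mirror period. Then Ψ is infinitely differentiable on ℝ and satisfies the (ℓ+1)-st order ordinary differential equation ((iλ_1 − d/dx) ∘ (iλ_2 − d/dx) ∘ ⋯ ∘ (iλ_{ℓ+1} − d/dx)) Ψ(x) = e^x Ψ(x) for all x ∈ ℝ, where each factor iλ_j − d/dx denotes the operator f ↦ iλ_j f − f′. -/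
open MeasureTheory Complex

/-- The mirror period `Ψ` for projective space `ℙ^ℓ` (with parameters
`λ_1, …, λ_{ℓ+1}`): the integral over `(0,∞)^ℓ` of
`(∏ t_i^{iλ_i} e^{-t_i}) (e^x ∏ t_i⁻¹)^{iλ_{ℓ+1}} exp(-e^x ∏ t_i⁻¹) ∏ dt_i/t_i`. -/
noncomputable def mirrorPeriod (ℓ : ℕ) (lam : Fin (ℓ + 1) → ℝ) (x : ℝ) : ℂ :=
  ∫ t in {t : Fin ℓ → ℝ | ∀ i, 0 < t i},
    (∏ i : Fin ℓ, ((t i : ℂ) ^ (Complex.I * (lam i.castSucc : ℂ))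
        * Complex.exp (-(t i : ℂ))))
      * ((Real.exp x * ∏ i : Fin ℓ, (t i)⁻¹ : ℝ) : ℂ) ^ (Complex.I * (lam (Fin.last ℓ) : ℂ))
      * Complex.exp (-((Real.exp x * ∏ i : Fin ℓ, (t i)⁻¹ : ℝ) : ℂ))
      * (∏ i : Fin ℓ, ((t i : ℂ)⁻¹))

/-- The first-order operator `f ↦ iμ f - f'` on functions `ℝ → ℂ`. -/
noncomputable def lowerOp (μ : ℝ) (f : ℝ → ℂ) : ℝ → ℂ :=
  fun x => Complex.I * (μ : ℂ) * f x - deriv f x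

namespace MirrorAux

open Set Filter Topology

/-- Gamma kernel. -/
noncomputable def gk (s : ℂ) (t : ℝ) : ℂ := (t : ℂ) ^ (s - 1) * Complex.exp (-(t : ℂ))

noncomputable def H (s : ℂ) (y : ℝ) : ℂ := Complex.exp (s * y - Complex.exp y)

noncomputable def T (s : ℂ) (f : ℝ → ℂ) (x : ℝ) : ℂ :=
  ∫ t in Ioi (0 : ℝ), gk s t * f (x - Real.log t)

noncomputable def Phi : (ℓ : ℕ) → (Fin (ℓ + 1) → ℂ) → ℝ → ℂ
  | 0, s => H (s 0)
  | ℓ + 1, s => T (s 0) (Phi ℓ (fun i => s i.succ))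

def Bd (f : ℝ → ℂ) : Prop := ∃ C, ∀ x, ‖f x‖ ≤ C

def B : ℕ → (ℝ → ℂ) → Prop
  | 0, f => Continuous f ∧ Bd f
  | n + 1, f => Differentiable ℝ f ∧ Bd f ∧ B n (deriv f)

noncomputable def L (s : ℂ) (f : ℝ → ℂ) : ℝ → ℂ := fun x => s * f x - deriv f x

lemma gk_int {s : ℂ} (hs : 0 < s.re) : IntegrableOn (gk s) (Ioi 0) := by
  refine (Complex.GammaIntegral_convergent hs).congr_fun (fun t _ => ?_) measurableSet_Ioi
  simp [gk, mul_comm]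

lemma Bd.sub {f g : ℝ → ℂ} (hf : Bd f) (hg : Bd g) : Bd (fun x => f x - g x) := by
  obtain ⟨C, hC⟩ := hf
  obtain ⟨D, hD⟩ := hg
  exact ⟨C + D, fun x => (norm_sub_le _ _).trans (add_le_add (hC x) (hD x))⟩

lemma Bd.mul {f : ℝ → ℂ} (hf : Bd f) (c : ℂ) : Bd (fun x => c * f x) := by
  obtain ⟨C, hC⟩ := hf
  refine ⟨‖c‖ * C, fun x => ?_⟩
  rw [norm_mul]
  exact mul_le_mul_of_nonneg_left (hC x) (norm_nonneg _)

lemma B.bd {n : ℕ} {f : ℝ → ℂ} (h : B n f) : Bd f := by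
  cases n with
  | zero => exact h.2
  | succ n => exact h.2.1

lemma B.cont {n : ℕ} {f : ℝ → ℂ} (h : B n f) : Continuous f := by
  cases n with
  | zero => exact h.1
  | succ n => exact h.1.continuous

lemma B.sub : ∀ {n : ℕ} {f g : ℝ → ℂ}, B n f → B n g → B n (fun x => f x - g x)
  | 0, _, _, hf, hg => ⟨hf.1.sub hg.1, hf.2.sub hg.2⟩
  | n + 1, f, g, hf, hg => by
    refine ⟨hf.1.sub hg.1, hf.2.1.sub hg.2.1, ?_⟩
    have : deriv (fun x => f x - g x) = fun x => deriv f x - deriv g x := by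
      ext x; exact deriv_fun_sub (hf.1 x) (hg.1 x)
    rw [this]
    exact B.sub hf.2.2 hg.2.2

lemma B.mul (c : ℂ) : ∀ {n : ℕ} {f : ℝ → ℂ}, B n f → B n (fun x => c * f x)
  | 0, _, hf => ⟨continuous_const.mul hf.1, hf.2.mul c⟩
  | n + 1, f, hf => by
    refine ⟨hf.1.const_mul c, hf.2.1.mul c, ?_⟩
    have : deriv (fun x => c * f x) = fun x => c * deriv f x := by
      ext x; exact deriv_const_mul c (hf.1 x)
    rw [this]
    exact B.mul c hf.2.2

lemma B.of_succ : ∀ {n : ℕ} {f : ℝ → ℂ}, B (n + 1) f → B n f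
  | 0, _, hf => ⟨hf.1.continuous, hf.2.1⟩
  | _ + 1, _, hf => ⟨hf.1, hf.2.1, B.of_succ hf.2.2⟩

lemma B.L {n : ℕ} {f : ℝ → ℂ} (s : ℂ) (h : B (n + 1) f) : B n (L s f) :=
  B.sub (B.mul s h.of_succ) h.2.2

lemma B.contDiff : ∀ {n : ℕ} {f : ℝ → ℂ}, B n f → ContDiff ℝ n f
  | 0, _, hf => by
    have := (contDiff_zero (𝕜 := ℝ)).2 hf.1
    simpa using this
  | n + 1, f, hf => by
    push_cast
    rw [contDiff_succ_iff_deriv]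
    exact ⟨hf.1, by simp, B.contDiff hf.2.2⟩

lemma H_hasDeriv (s : ℂ) (y : ℝ) : HasDerivAt (H s) (s * H s y - H (s + 1) y) y := by
  have h1 : HasDerivAt (fun y : ℝ => (y : ℂ)) 1 y := Complex.ofRealCLM.hasDerivAt
  have h : HasDerivAt (H s) _ y := ((h1.const_mul s).sub h1.cexp).cexp
  refine h.congr_deriv ?_
  simp only [H, Pi.sub_apply]
  rw [show (s + 1) * (y : ℂ) - cexp y = (s * y - cexp y) + y by ring, Complex.exp_add]
  ring

lemma H_norm (s : ℂ) (y : ℝ) : ‖H s y‖ = Real.exp (s.re * y - Real.exp y) := by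
  rw [H, Complex.norm_exp]
  congr 1
  rw [← Complex.ofReal_exp, Complex.sub_re, Complex.ofReal_re, Complex.re_mul_ofReal]

lemma H_bd {s : ℂ} (hs : 0 < s.re) : Bd (H s) := by
  refine ⟨Real.exp (s.re * (Real.log s.re - 1)), fun y => ?_⟩
  rw [H_norm]
  apply Real.exp_le_exp.2
  have h := Real.add_one_le_exp (y - Real.log s.re)
  have h2 : Real.exp y = s.re * Real.exp (y - Real.log s.re) := by
    rw [Real.exp_sub, Real.exp_log hs]; field_simp
  rw [h2]
  nlinarith [mul_le_mul_of_nonneg_left h hs.le]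

lemma H_B : ∀ (n : ℕ) {s : ℂ}, 0 < s.re → B n (H s)
  | 0, s, hs => ⟨by unfold H; fun_prop, H_bd hs⟩
  | n + 1, s, hs => by
    refine ⟨fun y => (H_hasDeriv s y).differentiableAt, H_bd hs, ?_⟩
    have : deriv (H s) = fun y => s * H s y - H (s + 1) y := by
      ext y; exact (H_hasDeriv s y).deriv
    rw [this]
    refine B.sub (B.mul s (H_B n hs)) (H_B n ?_)
    simp; linarith

lemma H_L (s : ℂ) : L s (H s) = H (s + 1) := by
  ext y
  rw [L, (H_hasDeriv s y).deriv]; ring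

lemma comp_meas {f : ℝ → ℂ} (hf : Continuous f) (x : ℝ) (μ : Measure ℝ) :
    AEStronglyMeasurable (fun t => f (x - Real.log t)) μ :=
  (hf.measurable.comp (measurable_const.sub Real.measurable_log)).aestronglyMeasurable

lemma T_int {s : ℂ} (hs : 0 < s.re) {f : ℝ → ℂ} (hf : Continuous f) (hb : Bd f) (x : ℝ) :
    IntegrableOn (fun t => gk s t * f (x - Real.log t)) (Ioi 0) := by
  obtain ⟨C, hC⟩ := hb
  exact Integrable.mul_bdd (c := C) (gk_int hs) (comp_meas hf x _) (Eventually.of_forall fun t => hC _)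

lemma T_bd {s : ℂ} (hs : 0 < s.re) {f : ℝ → ℂ} (hb : Bd f) : Bd (T s f) := by
  obtain ⟨C, hC⟩ := hb
  refine ⟨∫ t in Ioi (0 : ℝ), ‖gk s t‖ * C, fun x => ?_⟩
  refine norm_integral_le_of_norm_le ((gk_int hs).norm.mul_const C)
    (Eventually.of_forall fun t => ?_)
  rw [norm_mul]
  exact mul_le_mul_of_nonneg_left (hC _) (norm_nonneg _)

lemma T_cont {s : ℂ} (hs : 0 < s.re) {f : ℝ → ℂ} (hf : Continuous f) (hb : Bd f) :
    Continuous (T s f) := by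
  obtain ⟨C, hC⟩ := id hb
  refine continuous_of_dominated (bound := fun t => ‖gk s t‖ * C)
    (fun x => (T_int hs hf hb x).1)
    (fun x => Eventually.of_forall fun t => ?_) ((gk_int hs).norm.mul_const C)
    (Eventually.of_forall fun t => by fun_prop)
  rw [norm_mul]
  exact mul_le_mul_of_nonneg_left (hC _) (norm_nonneg _)

lemma T_hasDeriv {s : ℂ} (hs : 0 < s.re) {f : ℝ → ℂ} (hf : B 1 f) (x : ℝ) :
    HasDerivAt (T s f) (T s (deriv f) x) x := by
  obtain ⟨C, hC⟩ := hf.2.2.2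
  refine (hasDerivAt_integral_of_dominated_loc_of_deriv_le (s := univ)
    (F' := fun x t => gk s t * deriv f (x - Real.log t))
    (bound := fun t => ‖gk s t‖ * C) univ_mem
    (Eventually.of_forall fun x => (T_int hs hf.cont hf.bd x).1) (T_int hs hf.cont hf.bd x)
    (T_int hs hf.2.2.1 hf.2.2.2 x).1
    (Eventually.of_forall fun t x _ => ?_) ((gk_int hs).norm.mul_const C)
    (Eventually.of_forall fun t x _ => ?_)).2
  · rw [norm_mul]
    exact mul_le_mul_of_nonneg_left (hC _) (norm_nonneg _)
  · exact (((hf.1 (x - Real.log t)).hasDerivAt).comp_sub_const x (Real.log t)).const_mul _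

lemma T_deriv {s : ℂ} (hs : 0 < s.re) {f : ℝ → ℂ} (hf : B 1 f) :
    deriv (T s f) = T s (deriv f) := by
  ext x; exact (T_hasDeriv hs hf x).deriv

lemma B.one : ∀ {n : ℕ} {f : ℝ → ℂ}, B (n + 1) f → B 1 f
  | 0, _, h => h
  | _ + 1, _, h => B.one h.of_succ

lemma T_B {s : ℂ} (hs : 0 < s.re) : ∀ (n : ℕ) {f : ℝ → ℂ}, B n f → B n (T s f)
  | 0, _, hf => ⟨T_cont hs hf.1 hf.2, T_bd hs hf.2⟩
  | n + 1, f, hf => by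
    refine ⟨fun x => (T_hasDeriv hs hf.one x).differentiableAt, T_bd hs hf.2.1, ?_⟩
    rw [T_deriv hs hf.one]
    exact T_B hs n hf.2.2

lemma T_L {s : ℂ} (hs : 0 < s.re) {f : ℝ → ℂ} (hf : B 1 f) (r : ℂ) :
    L r (T s f) = T s (L r f) := by
  ext x
  rw [L, T_deriv hs hf]
  simp only [T, L]
  rw [← integral_const_mul, ← integral_sub ((T_int hs hf.cont hf.bd x).const_mul r)
    (T_int hs hf.2.2.1 hf.2.2.2 x)]
  congr 1; ext t; ring

lemma gk_succ (s : ℂ) {t : ℝ} (ht : 0 < t) : gk (s + 1) t = t * gk s t := by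
  have : (t : ℂ) ≠ 0 := by exact_mod_cast ht.ne'
  simp only [gk]
  rw [show s + 1 - 1 = (s - 1) + 1 by ring, Complex.cpow_add _ _ this, Complex.cpow_one]
  ring

lemma T_ibp {s : ℂ} (hs : 0 < s.re) {f : ℝ → ℂ} (hf : B 1 f) :
    L s (T s f) = T (s + 1) f := by
  have hs1 : 0 < (s + 1).re := by simp; linarith
  ext x
  rw [L, T_deriv hs hf]
  obtain ⟨C, hC⟩ := hf.bd
  have hnorm : ∀ t : ℝ, 0 ≤ t → ‖gk (s + 1) t * f (x - Real.log t)‖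
      ≤ (t ^ s.re * Real.exp (-1 * t)) * C := by
    intro t ht
    rw [norm_mul]
    refine mul_le_mul (le_of_eq ?_) (hC _) (norm_nonneg _) (by positivity)
    rw [gk, norm_mul, Complex.norm_exp, add_sub_cancel_right]
    rw [Complex.norm_cpow_eq_rpow_re_of_nonneg ht hs.ne']
    simp
  have h0 : gk (s + 1) 0 = 0 := by
    rw [gk, add_sub_cancel_right, Complex.ofReal_zero, Complex.zero_cpow, zero_mul]
    rintro rfl; simp at hs
  have key := integral_Ioi_of_hasDerivAt_of_tendsto (a := 0) (m := 0)
    (f := fun t => gk (s + 1) t * f (x - Real.log t))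
    (f' := fun t => (s * (gk s t * f (x - Real.log t)) - gk (s + 1) t * f (x - Real.log t))
      - gk s t * deriv f (x - Real.log t)) ?_ ?_ ?_ ?_
  · rw [integral_sub, integral_sub, integral_const_mul] at key
    · simp only [h0, zero_mul, sub_zero] at key
      simp only [T]
      linear_combination key
    · exact (T_int hs hf.cont hf.bd x).const_mul s
    · exact T_int hs1 hf.cont hf.bd x
    · exact ((T_int hs hf.cont hf.bd x).const_mul s).sub (T_int hs1 hf.cont hf.bd x)
    · exact T_int hs hf.2.2.1 hf.2.2.2 x
  · unfold ContinuousWithinAt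
    simp only [h0, zero_mul]
    refine squeeze_zero_norm' (a := fun t => (t ^ s.re * Real.exp (-1 * t)) * C) ?_ ?_
    · filter_upwards [self_mem_nhdsWithin] with t ht using hnorm t ht
    · have : Continuous fun t : ℝ => (t ^ s.re * Real.exp (-1 * t)) * C :=
        ((Real.continuous_rpow_const hs.le).mul (by fun_prop)).mul continuous_const
      have h := this.tendsto 0
      rw [Real.zero_rpow hs.ne', zero_mul, zero_mul] at h
      exact h.mono_left nhdsWithin_le_nhds
  · intro t ht
    have ht : 0 < t := ht
    have htc : (t : ℂ) ≠ 0 := by exact_mod_cast ht.ne'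
    have hs0 : s ≠ 0 := by rintro rfl; simp at hs
    have h1 : HasDerivAt (fun y : ℝ => (y : ℂ)) 1 t := Complex.ofRealCLM.hasDerivAt
    have h2 : HasDerivAt (fun y : ℝ => (y : ℂ) ^ s) (s * (t : ℂ) ^ (s - 1)) t := by
      have := HasDerivAt.comp_ofReal (z := t)
        ((hasDerivAt_id (t : ℂ)).cpow_const (c := s) (Or.inl (by simpa using ht)))
      simpa using this
    have h3 : HasDerivAt (gk (s + 1)) (s * gk s t - gk (s + 1) t) t := by
      have h5 : HasDerivAt (fun y : ℝ => (y : ℂ) ^ s * Complex.exp (-(y : ℂ))) _ t :=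
        h2.mul (h1.neg.cexp)
      have h6 : gk (s + 1) = fun y : ℝ => (y : ℂ) ^ s * Complex.exp (-(y : ℂ)) := by
        ext y; rw [gk, add_sub_cancel_right]
      rw [h6]
      refine h5.congr_deriv ?_
      simp only [gk, Pi.neg_apply]
      ring
    have h4 : HasDerivAt (fun y : ℝ => f (x - Real.log y))
        ((-t⁻¹ : ℝ) • deriv f (x - Real.log t)) t := by
      have h5 : HasDerivAt (fun y : ℝ => x - Real.log y) (-t⁻¹) t :=
        (Real.hasDerivAt_log ht.ne').const_sub x
      exact (hf.1 (x - Real.log t)).hasDerivAt.scomp t h5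
    refine (h3.mul h4).congr_deriv ?_
    rw [Complex.real_smul, gk_succ s ht]
    push_cast
    field_simp
    ring
  · exact (((T_int hs hf.cont hf.bd x).const_mul s).sub (T_int hs1 hf.cont hf.bd x)).sub
      (T_int hs hf.2.2.1 hf.2.2.2 x)
  · refine squeeze_zero_norm' (a := fun t => (t ^ s.re * Real.exp (-1 * t)) * C) ?_ ?_
    · filter_upwards [eventually_ge_atTop 0] with t ht using hnorm t ht
    · simpa using (tendsto_rpow_mul_exp_neg_mul_atTop_nhds_zero s.re 1 one_pos).mul_const C

lemma T_exp (s : ℂ) (f : ℝ → ℂ) (x : ℝ) :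
    T (s + 1) (fun y => (Real.exp y : ℂ) * f y) x = Real.exp x * T s f x := by
  simp only [T]
  rw [← integral_const_mul]
  refine setIntegral_congr_fun measurableSet_Ioi fun t ht => ?_
  have ht : 0 < t := ht
  have htc : (t : ℂ) ≠ 0 := by exact_mod_cast ht.ne'
  rw [gk_succ s ht, Real.exp_sub, Real.exp_log ht]
  push_cast
  field_simp

lemma Phi_B (n : ℕ) : ∀ (ℓ : ℕ) (s : Fin (ℓ + 1) → ℂ), (∀ i, 0 < (s i).re) → B n (Phi ℓ s)
  | 0, _, hs => H_B n (hs 0)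
  | ℓ + 1, _, hs => T_B (hs 0) n (Phi_B n ℓ _ fun i => hs i.succ)

lemma Phi_exp : ∀ (ℓ : ℕ) (s : Fin (ℓ + 1) → ℂ) (x : ℝ),
    Phi ℓ (fun i => s i + 1) x = Real.exp x * Phi ℓ s x
  | 0, s, x => by
    simp only [Phi, H]
    rw [Complex.ofReal_exp, ← Complex.exp_add]; congr 1; ring
  | ℓ + 1, s, x => by
    simp only [Phi]
    rw [← T_exp]
    congr 1
    ext y
    exact Phi_exp ℓ (fun i => s i.succ) y

/-- Composition of the operators. -/
noncomputable def P (l : List ℂ) : (ℝ → ℂ) → ℝ → ℂ := (l.map L).foldr (· ∘ ·) id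

lemma P_B : ∀ (l : List ℂ) {f : ℝ → ℂ}, (∀ n, B n f) → ∀ n, B n (P l f)
  | [], _, hf => hf
  | a :: l, _, hf => fun n => B.L a (P_B l hf (n + 1))

lemma P_T {s : ℂ} (hs : 0 < s.re) : ∀ (l : List ℂ) {f : ℝ → ℂ}, (∀ n, B n f) →
    P l (T s f) = T s (P l f)
  | [], _, _ => rfl
  | a :: l, f, hf => by
    change L a (P l (T s f)) = T s (L a (P l f))
    rw [P_T hs l hf, T_L hs (P_B l hf 1)]

lemma P_Phi : ∀ (ℓ : ℕ) (s : Fin (ℓ + 1) → ℂ), (∀ i, 0 < (s i).re) →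
    P (List.ofFn s) (Phi ℓ s) = Phi ℓ (fun i => s i + 1)
  | 0, s, _ => by
    simp only [List.ofFn_succ, List.ofFn_zero, Phi]
    exact H_L (s 0)
  | ℓ + 1, s, hs => by
    rw [List.ofFn_succ]
    change L (s 0) (P _ (T (s 0) (Phi ℓ fun i => s i.succ))) = _
    have hB := fun n => Phi_B n ℓ (fun i => s i.succ) fun i => hs i.succ
    rw [P_T (hs 0) _ hB, T_ibp (hs 0) (P_B _ hB 1), P_Phi ℓ _ fun i => hs i.succ]
    rfl

lemma multi : ∀ (ℓ : ℕ) (s : Fin (ℓ + 1) → ℂ), (∀ i, 0 < (s i).re) → ∀ x : ℝ,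
    ∫ t : Fin ℓ → ℝ, (∏ i, gk (s i.castSucc) (t i)) * H (s (Fin.last ℓ)) (x - ∑ i, Real.log (t i))
      ∂(Measure.pi fun _ => (volume : Measure ℝ).restrict (Ioi 0)) = Phi ℓ s x
  | 0, s, hs, x => by
    simp [Phi, Measure.real]
  | ℓ + 1, s, hs, x => by
    have hmp := (measurePreserving_piFinSuccAbove
      (fun _ : Fin (ℓ + 1) => (volume : Measure ℝ).restrict (Ioi 0)) 0).symm
    have hint : Integrable (fun t : Fin (ℓ + 1) → ℝ => (∏ i, gk (s i.castSucc) (t i)) *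
        H (s (Fin.last (ℓ + 1))) (x - ∑ i, Real.log (t i)))
        (Measure.pi fun _ => (volume : Measure ℝ).restrict (Ioi 0)) := by
      obtain ⟨C, hC⟩ := H_bd (hs (Fin.last (ℓ + 1)))
      refine Integrable.mul_bdd (c := C) ?_ ?_ (Eventually.of_forall fun t => hC _)
      · exact Integrable.fintype_prod (f := fun (i : Fin (ℓ + 1)) t => gk (s i.castSucc) t)
          fun i => gk_int (hs _)
      · refine Measurable.aestronglyMeasurable ?_
        refine (H_B 0 (hs (Fin.last (ℓ + 1)))).1.measurable.comp ?_
        fun_prop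
    rw [← hmp.integral_comp']
    rw [← hmp.integrable_comp_emb (MeasurableEquiv.measurableEmbedding _)] at hint
    refine (integral_prod _ hint).trans ?_
    simp only [Phi, T]
    congr 1
    ext t
    rw [← multi ℓ (fun i => s i.succ) (fun i => hs i.succ), ← integral_const_mul]
    congr 1
    ext u
    simp [MeasurableEquiv.piFinSuccAbove_symm_apply, Fin.insertNthEquiv, Fin.prod_univ_succ,
      Fin.sum_univ_succ, sub_sub, mul_assoc]

lemma mirror_eq (ℓ : ℕ) (lam : Fin (ℓ + 1) → ℝ) (x : ℝ) :
    mirrorPeriod ℓ lam x = Complex.exp (-x) * Phi ℓ (fun i => 1 + Complex.I * lam i) x := by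
  rw [← multi ℓ _ (fun i => by simp), ← Measure.restrict_pi_pi, ← volume_pi, mirrorPeriod,
    ← integral_const_mul]
  have hset : {t : Fin ℓ → ℝ | ∀ i, 0 < t i} = univ.pi fun _ => Ioi 0 := by
    ext t; simp
  rw [hset]
  refine setIntegral_congr_fun (MeasurableSet.univ_pi fun _ => measurableSet_Ioi) fun t ht => ?_
  have ht : ∀ i, 0 < t i := fun i => ht i (mem_univ i)
  have hE : Real.exp x * ∏ i, (t i)⁻¹ = Real.exp (x - ∑ i, Real.log (t i)) := by
    rw [Real.exp_sub, Real.exp_sum, Finset.prod_inv_distrib, div_eq_mul_inv]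
    congr 2
    exact Finset.prod_congr rfl fun i _ => (Real.exp_log (ht i)).symm
  rw [hE]
  set y := x - ∑ i, Real.log (t i) with hy
  have h1 : ((Real.exp y : ℝ) : ℂ) ^ (Complex.I * (lam (Fin.last ℓ) : ℂ))
      = Complex.exp (Complex.I * lam (Fin.last ℓ) * y) := by
    rw [Complex.cpow_def_of_ne_zero (by exact_mod_cast (Real.exp_pos y).ne'),
      ← Complex.ofReal_log (Real.exp_pos y).le, Real.log_exp, mul_comm]
  have h2 : H (1 + Complex.I * lam (Fin.last ℓ)) y
      = Complex.exp x * (∏ i, ((t i : ℂ))⁻¹) * Complex.exp (Complex.I * lam (Fin.last ℓ) * y)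
        * Complex.exp (-((Real.exp y : ℝ) : ℂ)) := by
    have : Complex.exp x * (∏ i, ((t i : ℂ))⁻¹) = Complex.exp y := by
      rw [← Complex.ofReal_exp y, ← hE]; push_cast; rfl
    rw [this, ← Complex.exp_add, ← Complex.exp_add, H]
    congr 1
    push_cast; ring
  have h3 : Complex.exp (-(x : ℂ)) * Complex.exp x = 1 := by
    rw [← Complex.exp_add]; simp
  rw [h1, h2]
  simp only [gk, add_sub_cancel_left]
  linear_combination (-(∏ i : Fin ℓ, ((t i : ℂ) ^ (Complex.I * (lam i.castSucc : ℂ))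
        * Complex.exp (-(t i : ℂ)))) * (∏ i, ((t i : ℂ))⁻¹)
        * Complex.exp (Complex.I * lam (Fin.last ℓ) * y)
        * Complex.exp (-((Real.exp y : ℝ) : ℂ))) * h3

lemma lowerOp_exp (μ : ℝ) {f : ℝ → ℂ} (hf : B 1 f) :
    lowerOp μ (fun x : ℝ => Complex.exp (-x) * f x)
      = fun x : ℝ => Complex.exp (-x) * L (1 + Complex.I * μ) f x := by
  ext x
  have h1 : HasDerivAt (fun y : ℝ => (y : ℂ)) 1 x := Complex.ofRealCLM.hasDerivAt
  have h2 : HasDerivAt (fun x : ℝ => Complex.exp (-x) * f x) _ x :=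
    (h1.neg.cexp).mul (hf.1 x).hasDerivAt
  rw [lowerOp, L, h2.deriv]
  simp only [Pi.neg_apply]
  ring

lemma fold_exp : ∀ (l : List ℝ) {f : ℝ → ℂ}, (∀ n, B n f) →
    ((l.map lowerOp).foldr (· ∘ ·) id) (fun x : ℝ => Complex.exp (-x) * f x)
      = fun x : ℝ => Complex.exp (-x) * P (l.map fun μ : ℝ => 1 + Complex.I * μ) f x
  | [], _, _ => rfl
  | a :: l, f, hf => by
    change lowerOp a (((l.map lowerOp).foldr (· ∘ ·) id)
      (fun x : ℝ => Complex.exp (-x) * f x)) = _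
    rw [fold_exp l hf, lowerOp_exp a (P_B _ hf 1)]
    rfl

end MirrorAux

/-- The `ℙ^ℓ` mirror period `Ψ` is infinitely differentiable on `ℝ` and satisfies
the `(ℓ+1)`-st order quantum differential equation
`((iλ_1 - d/dx) ∘ (iλ_2 - d/dx) ∘ ⋯ ∘ (iλ_{ℓ+1} - d/dx)) Ψ(x) = e^x Ψ(x)`. -/
theorem mirrorPeriod_quantum_ODE (ℓ : ℕ) (hℓ : 1 ≤ ℓ) (lam : Fin (ℓ + 1) → ℝ) :
    ContDiff ℝ (⊤ : ℕ∞) (mirrorPeriod ℓ lam) ∧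
    ∀ x : ℝ,
      ((List.ofFn fun j : Fin (ℓ + 1) => lowerOp (lam j)).foldr (· ∘ ·) id)
          (mirrorPeriod ℓ lam) x
        = Real.exp x * mirrorPeriod ℓ lam x := by
  have hB := fun n => MirrorAux.Phi_B n ℓ (fun i => 1 + Complex.I * lam i) (fun i => by simp)
  have hEq : mirrorPeriod ℓ lam = fun x : ℝ => Complex.exp (-x) *
      MirrorAux.Phi ℓ (fun i => 1 + Complex.I * lam i) x := funext (MirrorAux.mirror_eq ℓ lam)
  constructor
  · rw [hEq]
    refine ContDiff.mul ?_ (contDiff_infty.2 fun n => (hB n).contDiff)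
    exact (Complex.ofRealCLM.contDiff.neg).cexp
  · intro x
    have hl : (List.ofFn fun j : Fin (ℓ + 1) => lowerOp (lam j))
        = (List.ofFn lam).map lowerOp := by
      rw [List.map_ofFn]; rfl
    have hl2 : ((List.ofFn lam).map fun μ : ℝ => 1 + Complex.I * (μ : ℂ))
        = List.ofFn fun i => 1 + Complex.I * (lam i : ℂ) := by
      rw [List.map_ofFn]; rfl
    rw [hl, hEq, MirrorAux.fold_exp _ hB, hl2, MirrorAux.P_Phi _ _ (fun i => by simp)]
    beta_reduce
    rw [MirrorAux.Phi_exp ℓ (fun i => 1 + Complex.I * (lam i : ℂ)) x]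
    ring
end

section
/- Fix an integer ℓ ≥ 1 and real numbers λ_1,…,λ_{ℓ+1}, and let Ψ be the ℙ^ℓ mirror period. Then Ψ is differentiable and for every x ∈ ℝ, iλ_{ℓ+1} Ψ(x) − Ψ′(x) = ∫_{(0,∞)^ℓ} (e^x ∏_{i=1}^{ℓ} t_i^{−1}) · (∏_{i=1}^{ℓ} t_i^{iλ_i} e^{−t_i}) · (e^x ∏_{i=1}^{ℓ} t_i^{−1})^{iλ_{ℓ+1}} · exp(−e^x ∏_{i=1}^{ℓ} t_i^{−1}) ∏_{i=1}^{ℓ} dt_i/t_i; that is, applying the operator (iλ_{ℓ+1} − d/dx) to Ψ inserts the factor t_{ℓ+1} = e^x ∏ t_i^{−1} into the integrand. -/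
open MeasureTheory Complex

/-- The integrand of the mirror period. -/
noncomputable def mpF (ℓ : ℕ) (lam : Fin (ℓ + 1) → ℝ) (x : ℝ) (t : Fin ℓ → ℝ) : ℂ :=
    (∏ i : Fin ℓ, ((t i : ℂ) ^ (Complex.I * (lam i.castSucc : ℂ))
        * Complex.exp (-(t i : ℂ))))
      * ((Real.exp x * ∏ i : Fin ℓ, (t i)⁻¹ : ℝ) : ℂ) ^ (Complex.I * (lam (Fin.last ℓ) : ℂ))
      * Complex.exp (-((Real.exp x * ∏ i : Fin ℓ, (t i)⁻¹ : ℝ) : ℂ))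
      * (∏ i : Fin ℓ, ((t i : ℂ)⁻¹))

/-- Its `x`-derivative. -/
noncomputable def mpF' (ℓ : ℕ) (lam : Fin (ℓ + 1) → ℝ) (x : ℝ) (t : Fin ℓ → ℝ) : ℂ :=
  (Complex.I * (lam (Fin.last ℓ) : ℂ) - ((Real.exp x * ∏ i : Fin ℓ, (t i)⁻¹ : ℝ) : ℂ))
    * mpF ℓ lam x t

lemma mpF_measurable (ℓ : ℕ) (lam : Fin (ℓ + 1) → ℝ) (x : ℝ) : Measurable (mpF ℓ lam x) := by
  unfold mpF
  fun_prop

lemma mpF'_measurable (ℓ : ℕ) (lam : Fin (ℓ + 1) → ℝ) (x : ℝ) : Measurable (mpF' ℓ lam x) := by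
  unfold mpF'
  have := mpF_measurable ℓ lam x
  fun_prop

lemma norm_cpow_I (y r : ℝ) (hy : 0 < y) : ‖(y : ℂ) ^ (Complex.I * (r : ℂ))‖ = 1 := by
  rw [Complex.norm_cpow_eq_rpow_re_of_pos hy]; simp

lemma mpF_norm (ℓ : ℕ) (lam : Fin (ℓ + 1) → ℝ) (x : ℝ) (t : Fin ℓ → ℝ) (ht : ∀ i, 0 < t i) :
    ‖mpF ℓ lam x t‖ = (∏ i, Real.exp (-t i)) *
      Real.exp (-(Real.exp x * ∏ i : Fin ℓ, (t i)⁻¹)) * ∏ i, (t i)⁻¹ := by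
  have hP : 0 < ∏ i : Fin ℓ, (t i)⁻¹ := Finset.prod_pos fun i _ => inv_pos.2 (ht i)
  have hy : 0 < Real.exp x * ∏ i : Fin ℓ, (t i)⁻¹ := mul_pos (Real.exp_pos x) hP
  unfold mpF
  rw [norm_mul, norm_mul, norm_mul, norm_cpow_I _ _ hy, norm_prod, norm_prod, Complex.norm_exp,
    mul_one]
  congr 1
  · congr 1
    · refine Finset.prod_congr rfl fun i _ => ?_
      rw [norm_mul, norm_cpow_I _ _ (ht i), Complex.norm_exp]
      simp
  · refine Finset.prod_congr rfl fun i _ => ?_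
    rw [norm_inv, Complex.norm_real, Real.norm_of_nonneg (ht i).le]

lemma exp_bounds (y : ℝ) (hy : 0 < y) :
    y * Real.exp (-y) ≤ 1 ∧ y * (y * Real.exp (-y)) ≤ 2 := by
  have h := Real.quadratic_le_exp_of_nonneg hy.le
  have he := Real.exp_pos y
  rw [Real.exp_neg]
  constructor
  · rw [← div_eq_mul_inv, div_le_one he]; nlinarith
  · rw [← div_eq_mul_inv, ← mul_div_assoc, div_le_iff₀ he]; nlinarith

lemma mpF_bound (ℓ : ℕ) (lam : Fin (ℓ + 1) → ℝ) (x : ℝ) (t : Fin ℓ → ℝ) (ht : ∀ i, 0 < t i) :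
    ‖mpF ℓ lam x t‖ ≤ Real.exp (-x) * ∏ i, Real.exp (-t i) ∧
    ‖mpF' ℓ lam x t‖ ≤ (|lam (Fin.last ℓ)| + 2) * Real.exp (-x) * ∏ i, Real.exp (-t i) := by
  have hP : 0 < ∏ i : Fin ℓ, (t i)⁻¹ := Finset.prod_pos fun i _ => inv_pos.2 (ht i)
  have hy : 0 < Real.exp x * ∏ i : Fin ℓ, (t i)⁻¹ := mul_pos (Real.exp_pos x) hP
  have hE : 0 < ∏ i, Real.exp (-t i) := Finset.prod_pos fun i _ => Real.exp_pos _
  have hn := mpF_norm ℓ lam x t ht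
  have hc : ‖Complex.I * (lam (Fin.last ℓ) : ℂ)
      - ((Real.exp x * ∏ i : Fin ℓ, (t i)⁻¹ : ℝ) : ℂ)‖ ≤
      |lam (Fin.last ℓ)| + Real.exp x * ∏ i : Fin ℓ, (t i)⁻¹ := by
    refine (norm_sub_le _ _).trans (le_of_eq ?_)
    rw [Complex.norm_real, Real.norm_of_nonneg hy.le]
    simp
  have hPe : ∏ i : Fin ℓ, (t i)⁻¹ = Real.exp (-x) * (Real.exp x * ∏ i : Fin ℓ, (t i)⁻¹) := by
    rw [← mul_assoc, ← Real.exp_add]; simp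
  obtain ⟨h1, h2⟩ := exp_bounds _ hy
  set y := Real.exp x * ∏ i : Fin ℓ, (t i)⁻¹ with hydef
  have hn' : ‖mpF ℓ lam x t‖ =
      Real.exp (-x) * (∏ i, Real.exp (-t i)) * (y * Real.exp (-y)) := by
    rw [hn, hPe]; ring
  have hK : 0 ≤ Real.exp (-x) * (∏ i, Real.exp (-t i)) :=
    mul_nonneg (Real.exp_pos _).le hE.le
  constructor
  · rw [hn']; exact mul_le_of_le_one_right hK h1
  · unfold mpF'
    rw [norm_mul]
    refine (mul_le_mul_of_nonneg_right hc (norm_nonneg _)).trans ?_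
    rw [hn']
    have h3 : |lam (Fin.last ℓ)| * (y * Real.exp (-y)) ≤ |lam (Fin.last ℓ)| :=
      mul_le_of_le_one_right (abs_nonneg _) h1
    calc _ = (Real.exp (-x) * (∏ i, Real.exp (-t i))) *
          (|lam (Fin.last ℓ)| * (y * Real.exp (-y)) + y * (y * Real.exp (-y))) := by ring
      _ ≤ (Real.exp (-x) * (∏ i, Real.exp (-t i))) * (|lam (Fin.last ℓ)| + 2) :=
          mul_le_mul_of_nonneg_left (add_le_add h3 h2) hK
      _ = _ := by ring

lemma mpF_hasDerivAt (ℓ : ℕ) (lam : Fin (ℓ + 1) → ℝ) (x : ℝ) (t : Fin ℓ → ℝ)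
    (ht : ∀ i, 0 < t i) : HasDerivAt (fun x => mpF ℓ lam x t) (mpF' ℓ lam x t) x := by
  have hP : 0 < ∏ i : Fin ℓ, (t i)⁻¹ := Finset.prod_pos fun i _ => inv_pos.2 (ht i)
  unfold mpF' mpF
  set P := ∏ i : Fin ℓ, (t i)⁻¹ with hPdef
  have hy : HasDerivAt (fun x : ℝ => ((Real.exp x * P : ℝ) : ℂ)) ((Real.exp x * P : ℝ) : ℂ) x :=
    ((Real.hasDerivAt_exp x).mul_const P).ofReal_comp
  have hpos : 0 < Real.exp x * P := mul_pos (Real.exp_pos x) hP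
  have hne : ((Real.exp x * P : ℝ) : ℂ) ≠ 0 := by exact_mod_cast hpos.ne'
  have hc : HasDerivAt
      (fun x : ℝ => ((Real.exp x * P : ℝ) : ℂ) ^ (Complex.I * (lam (Fin.last ℓ) : ℂ)))
      (Complex.I * (lam (Fin.last ℓ) : ℂ) *
        ((Real.exp x * P : ℝ) : ℂ) ^ (Complex.I * (lam (Fin.last ℓ) : ℂ))) x := by
    have key : ∀ x : ℝ, ((Real.exp x * P : ℝ) : ℂ) ^ (Complex.I * (lam (Fin.last ℓ) : ℂ)) =
        Complex.exp (((x + Real.log P : ℝ) : ℂ) * (Complex.I * (lam (Fin.last ℓ) : ℂ))) := by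
      intro x
      have hpos : 0 < Real.exp x * P := mul_pos (Real.exp_pos x) hP
      rw [Complex.cpow_def_of_ne_zero (by exact_mod_cast hpos.ne'), ← Complex.ofReal_log hpos.le,
        Real.log_mul (Real.exp_pos x).ne' hP.ne', Real.log_exp]
    simp_rw [key]
    have h := ((((hasDerivAt_id x).add_const (Real.log P)).ofReal_comp).mul_const
      (Complex.I * (lam (Fin.last ℓ) : ℂ))).cexp
    refine h.congr_deriv ?_
    simp; ring
  have hall := (((hc.const_mul (∏ i : Fin ℓ, ((t i : ℂ) ^ (Complex.I * (lam i.castSucc : ℂ))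
        * Complex.exp (-(t i : ℂ))))).mul hy.neg.cexp).mul_const (∏ i : Fin ℓ, ((t i : ℂ)⁻¹)))
  refine hall.congr_deriv ?_
  simp only [Pi.neg_apply]
  ring

lemma mp_orthant (ℓ : ℕ) : {t : Fin ℓ → ℝ | ∀ i, 0 < t i} = Set.univ.pi fun _ => Set.Ioi 0 := by
  ext t; simp

lemma mp_bound_integrable (ℓ : ℕ) :
    IntegrableOn (fun t : Fin ℓ → ℝ => ∏ i, Real.exp (-t i)) {t | ∀ i, 0 < t i} := by
  rw [mp_orthant, IntegrableOn, volume_pi, Measure.restrict_pi_pi]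
  exact Integrable.fintype_prod (f := fun _ s => Real.exp (-s))
    fun i => integrableOn_exp_neg_Ioi 0

lemma mp_measurableSet (ℓ : ℕ) : MeasurableSet {t : Fin ℓ → ℝ | ∀ i, 0 < t i} := by
  rw [mp_orthant]
  exact MeasurableSet.univ_pi fun _ => measurableSet_Ioi

lemma mpF_integrable (ℓ : ℕ) (lam : Fin (ℓ + 1) → ℝ) (x : ℝ) :
    IntegrableOn (mpF ℓ lam x) {t | ∀ i, 0 < t i} := by
  refine ((mp_bound_integrable ℓ).const_mul (Real.exp (-x))).mono'
    (mpF_measurable ℓ lam x).aestronglyMeasurable ?_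
  filter_upwards [ae_restrict_mem (mp_measurableSet ℓ)] with t ht
  exact (mpF_bound ℓ lam x t ht).1

lemma mp_hasDerivAt (ℓ : ℕ) (lam : Fin (ℓ + 1) → ℝ) (x : ℝ) :
    IntegrableOn (mpF' ℓ lam x) {t | ∀ i, 0 < t i} ∧
    HasDerivAt (mirrorPeriod ℓ lam) (∫ t in {t | ∀ i, 0 < t i}, mpF' ℓ lam x t) x := by
  refine hasDerivAt_integral_of_dominated_loc_of_deriv_le (F := mpF ℓ lam) (F' := mpF' ℓ lam)
    (bound := fun t => (|lam (Fin.last ℓ)| + 2) * Real.exp (-(x - 1)) * ∏ i, Real.exp (-t i))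
    (Ioi_mem_nhds (show x - 1 < x by linarith))
    (Filter.Eventually.of_forall fun z => (mpF_measurable ℓ lam z).aestronglyMeasurable)
    (mpF_integrable ℓ lam x) (mpF'_measurable ℓ lam x).aestronglyMeasurable ?_
    ((mp_bound_integrable ℓ).const_mul _) ?_
  · filter_upwards [ae_restrict_mem (mp_measurableSet ℓ)] with t ht z hz
    refine (mpF_bound ℓ lam z t ht).2.trans ?_
    have hz' : x - 1 < z := hz
    gcongr
  · filter_upwards [ae_restrict_mem (mp_measurableSet ℓ)] with t ht z hz
    exact mpF_hasDerivAt ℓ lam z t ht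

/-- The `ℙ^ℓ` mirror period `Ψ` is differentiable, and applying the operator
`iλ_{ℓ+1} - d/dx` to it inserts the factor `t_{ℓ+1} = e^x ∏ t_i⁻¹` into the
integrand:
`iλ_{ℓ+1} Ψ(x) - Ψ'(x) = ∫ (e^x ∏ t_i⁻¹) (∏ t_i^{iλ_i} e^{-t_i})
(e^x ∏ t_i⁻¹)^{iλ_{ℓ+1}} exp(-e^x ∏ t_i⁻¹) ∏ dt_i/t_i`. -/
theorem mirrorPeriod_first_order_step (ℓ : ℕ) (hℓ : 1 ≤ ℓ)
    (lam : Fin (ℓ + 1) → ℝ) :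
    Differentiable ℝ (mirrorPeriod ℓ lam) ∧
    ∀ x : ℝ,
      Complex.I * (lam (Fin.last ℓ) : ℂ) * mirrorPeriod ℓ lam x
          - deriv (mirrorPeriod ℓ lam) x
        = ∫ t in {t : Fin ℓ → ℝ | ∀ i, 0 < t i},
            ((Real.exp x * ∏ i : Fin ℓ, (t i)⁻¹ : ℝ) : ℂ)
              * (∏ i : Fin ℓ, ((t i : ℂ) ^ (Complex.I * (lam i.castSucc : ℂ))
                  * Complex.exp (-(t i : ℂ))))
              * ((Real.exp x * ∏ i : Fin ℓ, (t i)⁻¹ : ℝ) : ℂ)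
                  ^ (Complex.I * (lam (Fin.last ℓ) : ℂ))
              * Complex.exp (-((Real.exp x * ∏ i : Fin ℓ, (t i)⁻¹ : ℝ) : ℂ))
              * (∏ i : Fin ℓ, ((t i : ℂ)⁻¹)) := by
  refine ⟨fun x => (mp_hasDerivAt ℓ lam x).2.differentiableAt, fun x => ?_⟩
  obtain ⟨hi, hd⟩ := mp_hasDerivAt ℓ lam x
  rw [hd.deriv]
  change _ * (∫ t in {t : Fin ℓ → ℝ | ∀ i, 0 < t i}, mpF ℓ lam x t) - _ = _
  rw [← integral_const_mul, ← integral_sub ((mpF_integrable ℓ lam x).const_mul _) hi]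
  congr 1
  funext t
  unfold mpF' mpF
  ring
end

section
/- In the general toric setup, for every x ∈ ℝ^n the function ℝ^{N−n} → ℂ, s ↦ exp( ∑_{j=1}^N ( iλ_j u_j(x,s) − e^{u_j(x,s)} ) ) with u(x,s) = u_0(x) + V(s), is Lebesgue-integrable on ℝ^{N−n}. (The hypothesis ker m ∩ (−∞,0]^N = {0} guarantees that every nonzero v ∈ ker m has some strictly positive component, so ∑_j e^{u_j} → ∞ in every direction of the integration subspace.) Consequently the toric mirror period Ψ(x) is well defined for all x. -/
open MeasureTheory Complex

/-- The linear map `ℝ^N → ℝ^n` attached to the matrix `m = (m_j^α)`,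
`(Mu)^α = ∑_j m_j^α u_j`. -/
noncomputable def toricConstraintMap (n N : ℕ) (m : Matrix (Fin n) (Fin N) ℕ) :
    (Fin N → ℝ) →ₗ[ℝ] (Fin n → ℝ) :=
  Matrix.mulVecLin (m.map (Nat.cast : ℕ → ℝ))

/-- The toric mirror period in logarithmic coordinates: for a linear section `u0`
of the constraint map and a parametrization `V` of its kernel,
`Ψ(x) = ∫_{ℝ^{N-n}} exp(∑_j (iλ_j u_j(x,s) - e^{u_j(x,s)})) ds` with
`u(x,s) = u0(x) + V(s)`. -/
noncomputable def toricPeriod (n N : ℕ) (lam : Fin N → ℝ)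
    (u0 : (Fin n → ℝ) →ₗ[ℝ] (Fin N → ℝ))
    (V : (Fin (N - n) → ℝ) →ₗ[ℝ] (Fin N → ℝ)) (x : Fin n → ℝ) : ℂ :=
  ∫ s : Fin (N - n) → ℝ,
    Complex.exp (∑ j : Fin N,
      (Complex.I * (lam j : ℂ) * ((u0 x + V s) j : ℂ)
        - (Real.exp ((u0 x + V s) j) : ℂ)))

/-- Exponential decay in the norm is integrable in finite dimension. -/
theorem integrable_exp_neg_norm_aux (k : ℕ) (c : ℝ) (hc : 0 < c) :
    Integrable (fun s : Fin k → ℝ => Real.exp (-(c * ‖s‖))) volume := by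
  have h := (integrable_one_add_norm (E := Fin k → ℝ) (μ := volume) (r := ((k + 1 : ℕ) : ℝ))
    (by simp)).const_mul (Real.exp c * (k + 1).factorial / c ^ (k + 1))
  refine h.mono' (by fun_prop) (Filter.Eventually.of_forall fun s => ?_)
  have hp : 0 < 1 + ‖s‖ := by positivity
  rw [Real.norm_eq_abs, abs_of_pos (Real.exp_pos _), Real.rpow_neg hp.le, Real.rpow_natCast]
  have h2 := Real.pow_div_factorial_le_exp (c * (1 + ‖s‖)) (by positivity) (k + 1)
  have hf : (0 : ℝ) < (k + 1).factorial := by positivity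
  rw [div_le_iff₀ hf, mul_pow, mul_add, Real.exp_add, mul_one] at h2
  rw [← div_eq_mul_inv, div_div, le_div_iff₀ (by positivity), Real.exp_neg,
    inv_mul_le_iff₀ (Real.exp_pos _)]
  linarith

/-- A continuous positively homogeneous function, positive away from `0`, dominates the norm. -/
theorem exists_pos_mul_norm_le_aux (k : ℕ) (g : (Fin k → ℝ) → ℝ) (hg : Continuous g)
    (hhom : ∀ (t : ℝ) s, 0 ≤ t → g (t • s) = t * g s) (hpos : ∀ s, s ≠ 0 → 0 < g s) :
    ∃ c : ℝ, 0 < c ∧ ∀ s, c * ‖s‖ ≤ g s := by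
  have h0 : g 0 = 0 := by simpa using hhom 0 0 le_rfl
  rcases (Metric.sphere (0 : Fin k → ℝ) 1).eq_empty_or_nonempty with he | hne
  · refine ⟨1, one_pos, fun s => ?_⟩
    by_cases hs : s = 0
    · simp [hs, h0]
    · have : ‖s‖⁻¹ • s ∈ Metric.sphere (0 : Fin k → ℝ) 1 := by
        simp [norm_smul, hs]
      simp [he] at this
  · obtain ⟨z, hz, hmin⟩ := (isCompact_sphere (0 : Fin k → ℝ) 1).exists_isMinOn hne hg.continuousOn
    refine ⟨g z, hpos z ?_, fun s => ?_⟩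
    · rintro rfl
      simp at hz
    by_cases hs : s = 0
    · simp [hs, h0]
    · have hm : ‖s‖⁻¹ • s ∈ Metric.sphere (0 : Fin k → ℝ) 1 := by
        simp [norm_smul, hs]
      have h1 : g z ≤ g (‖s‖⁻¹ • s) := hmin hm
      have hn : 0 < ‖s‖ := norm_pos_iff.mpr hs
      rw [hhom _ _ (by positivity), le_inv_mul_iff₀ hn] at h1
      linarith

/-- In the general toric setup (constraint matrix `m` of nonnegative integers of
real rank `n`, with `ker m ∩ (-∞,0]^N = {0}`, a linear section `u0` of `m` and a
linear isomorphism `V` onto `ker m`), for every `x ∈ ℝ^n` the integrand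
`s ↦ exp(∑_j (iλ_j u_j(x,s) - e^{u_j(x,s)}))`, `u(x,s) = u0(x) + V(s)`, is
Lebesgue-integrable on `ℝ^{N-n}`; consequently the toric mirror period `Ψ(x)`
is well defined for all `x`. -/
theorem toricPeriod_integrable (n N : ℕ) (hn : 1 ≤ n) (hnN : n ≤ N)
    (m : Matrix (Fin n) (Fin N) ℕ) (lam : Fin N → ℝ)
    (hrank : Function.Surjective (toricConstraintMap n N m))
    (hker : ∀ v : Fin N → ℝ, toricConstraintMap n N m v = 0 → (∀ j, v j ≤ 0) → v = 0)
    (u0 : (Fin n → ℝ) →ₗ[ℝ] (Fin N → ℝ))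
    (hu0 : ∀ x, toricConstraintMap n N m (u0 x) = x)
    (V : (Fin (N - n) → ℝ) →ₗ[ℝ] (Fin N → ℝ))
    (hVinj : Function.Injective V)
    (hVrange : LinearMap.range V = LinearMap.ker (toricConstraintMap n N m)) :
    ∀ x : Fin n → ℝ,
      Integrable (fun s : Fin (N - n) → ℝ =>
        Complex.exp (∑ j : Fin N,
          (Complex.I * (lam j : ℂ) * ((u0 x + V s) j : ℂ)
            - (Real.exp ((u0 x + V s) j) : ℂ)))) volume := by
  intro x
  have hVc : Continuous V := V.continuous_of_finiteDimensional
  have hVj : ∀ j, Continuous fun s => V s j := fun j => (continuous_apply j).comp hVc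
  obtain ⟨c, hc, hle⟩ := exists_pos_mul_norm_le_aux (N - n)
    (fun s => ∑ j, Real.exp (u0 x j) * max (V s j) 0)
    (continuous_finsetSum _ fun j _ => continuous_const.mul ((hVj j).max continuous_const))
    (by
      intro t s ht
      rw [Finset.mul_sum]
      refine Finset.sum_congr rfl fun j _ => ?_
      have : max (t * V s j) 0 = t * max (V s j) 0 := by
        rw [mul_max_of_nonneg _ _ ht, mul_zero]
      simp only [map_smul, Pi.smul_apply, smul_eq_mul, this]
      ring)
    (by
      intro s hs
      by_contra hcon
      apply hs
      apply hVinj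
      rw [map_zero]
      have hk : V s ∈ LinearMap.ker (toricConstraintMap n N m) := by
        rw [← hVrange]; exact ⟨s, rfl⟩
      refine hker _ hk fun j => ?_
      by_contra hj
      push Not at hj
      apply hcon
      refine Finset.sum_pos' (fun i _ => by positivity) ⟨j, Finset.mem_univ j, ?_⟩
      exact mul_pos (Real.exp_pos _) (lt_max_of_lt_left hj))
  refine (integrable_exp_neg_norm_aux (N - n) c hc).mono' ?_ (Filter.Eventually.of_forall fun s => ?_)
  · refine Continuous.aestronglyMeasurable ?_
    refine Complex.continuous_exp.comp (continuous_finsetSum _ fun j _ => ?_)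
    have h1 : Continuous fun s => (u0 x + V s) j := continuous_const.add (hVj j)
    exact (continuous_const.mul (Complex.continuous_ofReal.comp h1)).sub
      (Complex.continuous_ofReal.comp (Real.continuous_exp.comp h1))
  · rw [Complex.norm_exp, Real.exp_le_exp, Complex.re_sum]
    have : ∀ j, (Complex.I * (lam j : ℂ) * ((u0 x + V s) j : ℂ)
        - (Real.exp ((u0 x + V s) j) : ℂ)).re = - Real.exp ((u0 x + V s) j) := by
      intro j
      rw [Complex.sub_re, Complex.ofReal_re, mul_assoc, ← Complex.ofReal_mul, Complex.I_mul_re,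
        Complex.ofReal_im]
      ring
    simp only [this]
    rw [Finset.sum_neg_distrib]
    refine neg_le_neg ((hle s).trans (Finset.sum_le_sum fun j _ => ?_))
    rw [Pi.add_apply, Real.exp_add]
    refine mul_le_mul_of_nonneg_left (max_le ?_ (Real.exp_pos _).le) (Real.exp_pos _).le
    linarith [Real.add_one_le_exp (V s j)]
end

section
/- In the general toric setup, the mirror period Ψ is a smooth function on ℝ^n and satisfies, for every α ∈ {1,…,n} and every x ∈ ℝ^n, the generalized hypergeometric (GKZ-type) differential equation ( ∏_{j=1}^N ∏_{k=0}^{m_j^α − 1} ( iλ_j + k − ∑_{β=1}^n m_j^β ∂/∂x^β ) ) Ψ(x) = e^{x^α} Ψ(x), where the left-hand side is the composition of the indicated first-order differential operators acting on Ψ (an empty product of factors, occurring when m_j^α = 0, is the identity). -/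
open MeasureTheory Complex

/-- The first-order differential operator
`f ↦ (iλ_j + k) f - ∑_β m_j^β ∂f/∂x^β` on functions `ℝ^n → ℂ`. -/
noncomputable def gkzFactor (n N : ℕ) (m : Matrix (Fin n) (Fin N) ℕ)
    (lam : Fin N → ℝ) (j : Fin N) (k : ℕ) (f : (Fin n → ℝ) → ℂ) :
    (Fin n → ℝ) → ℂ :=
  fun x => (Complex.I * (lam j : ℂ) + (k : ℂ)) * f x
    - ∑ β : Fin n, (m β j : ℂ) * fderiv ℝ f x (Pi.single β 1)

/-- The `α`-th GKZ operator `∏_{j=1}^N ∏_{k=0}^{m_j^α - 1} (iλ_j + k - ∑_β m_j^β ∂_{x^β})`: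
the composition of the indicated first-order operators (an empty product, when
`m_j^α = 0`, is the identity). -/
noncomputable def gkzOp (n N : ℕ) (m : Matrix (Fin n) (Fin N) ℕ)
    (lam : Fin N → ℝ) (α : Fin n) : ((Fin n → ℝ) → ℂ) → ((Fin n → ℝ) → ℂ) :=
  ((List.ofFn fun j : Fin N =>
      (List.ofFn fun k : Fin (m α j) => gkzFactor n N m lam j (k : ℕ))).flatten).foldr
    (· ∘ ·) id

/-- The integrand with weights `e^{c_j u_j}`. -/
noncomputable def toricPhi (N : ℕ) (lam : Fin N → ℝ) (c : Fin N → ℕ) (u : Fin N → ℝ) : ℂ :=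
  Complex.exp (∑ j : Fin N,
    ((Complex.I * (lam j : ℂ) + (c j : ℂ)) * (u j : ℂ) - (Real.exp (u j) : ℂ)))

/-- The integral of `toricPhi` over the translates of the kernel. -/
noncomputable def toricJ (N d : ℕ) (lam : Fin N → ℝ)
    (V : (Fin d → ℝ) →ₗ[ℝ] (Fin N → ℝ)) (c : Fin N → ℕ) (u : Fin N → ℝ) : ℂ :=
  ∫ s : Fin d → ℝ, toricPhi N lam c (u + V s)

/-- The derivative of `toricPhi`, or of `toricJ`. -/
noncomputable def toricD (N : ℕ) (lam : Fin N → ℝ) (c : Fin N → ℕ)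
    (F : (Fin N → ℕ) → ℂ) : (Fin N → ℝ) →L[ℝ] ℂ :=
  ∑ j : Fin N, (ContinuousLinearMap.proj (R := ℝ) (φ := fun _ : Fin N => ℝ) j).smulRight
    ((Complex.I * (lam j : ℂ) + (c j : ℂ)) * F c - F (c + Pi.single j 1))

lemma toricD_apply (N : ℕ) (lam : Fin N → ℝ) (c : Fin N → ℕ) (F : (Fin N → ℕ) → ℂ)
    (v : Fin N → ℝ) : toricD N lam c F v = ∑ j : Fin N, (v j : ℂ) *
      ((Complex.I * (lam j : ℂ) + (c j : ℂ)) * F c - F (c + Pi.single j 1)) := by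
  simp [toricD]

lemma toricPhi_add_single (N : ℕ) (lam : Fin N → ℝ) (c : Fin N → ℕ) (u : Fin N → ℝ)
    (j : Fin N) : toricPhi N lam (c + Pi.single j 1) u
      = (Real.exp (u j) : ℂ) * toricPhi N lam c u := by
  unfold toricPhi
  rw [Complex.ofReal_exp, ← Complex.exp_add]
  congr 1
  have : (u j : ℂ) = ∑ i : Fin N, ((Pi.single j 1 : Fin N → ℕ) i : ℂ) * (u i : ℂ) := by
    rw [Finset.sum_eq_single j]
    · simp
    · intro b _ hb
      simp [Pi.single_eq_of_ne hb]
    · simp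
  rw [this, ← Finset.sum_add_distrib]
  refine Finset.sum_congr rfl fun i _ => ?_
  simp only [Pi.add_apply]
  push_cast
  ring

lemma toricPhi_hasFDerivAt (N : ℕ) (lam : Fin N → ℝ) (c : Fin N → ℕ) (u : Fin N → ℝ) :
    HasFDerivAt (toricPhi N lam c) (toricD N lam c (fun c' => toricPhi N lam c' u)) u := by
  have hp : ∀ j : Fin N, HasFDerivAt (fun u : Fin N → ℝ => u j)
      (ContinuousLinearMap.proj (R := ℝ) (φ := fun _ : Fin N => ℝ) j) u :=
    fun j => (ContinuousLinearMap.proj (R := ℝ) (φ := fun _ : Fin N => ℝ) j).hasFDerivAt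
  have hpc : ∀ j : Fin N, HasFDerivAt (fun u : Fin N → ℝ => (u j : ℂ))
      (Complex.ofRealCLM.comp (ContinuousLinearMap.proj (R := ℝ) (φ := fun _ : Fin N => ℝ) j)) u :=
    fun j => Complex.ofRealCLM.hasFDerivAt.comp u (hp j)
  have hec : ∀ j : Fin N, HasFDerivAt (fun u : Fin N → ℝ => (Real.exp (u j) : ℂ))
      (Complex.ofRealCLM.comp (Real.exp (u j) •
        (ContinuousLinearMap.proj (R := ℝ) (φ := fun _ : Fin N => ℝ) j))) u :=
    fun j => Complex.ofRealCLM.hasFDerivAt.comp u (hp j).exp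
  have := (HasFDerivAt.fun_sum (u := Finset.univ) fun j _ =>
    ((hpc j).const_mul (Complex.I * (lam j : ℂ) + (c j : ℂ))).sub (hec j)).cexp
  unfold toricPhi
  refine this.congr_fderiv ?_
  refine ContinuousLinearMap.ext fun v => Eq.symm ?_
  have h2 := toricD_apply N lam c (fun c' => toricPhi N lam c' u) v
  simp only [toricPhi_add_single] at h2
  unfold toricPhi at h2
  rw [h2]
  simp only [smul_apply, sum_apply, smul_eq_mul,
    Finset.mul_sum]
  refine Finset.sum_congr rfl fun j _ => ?_
  simp
  ring

lemma toricPhi_continuous (N : ℕ) (lam : Fin N → ℝ) (c : Fin N → ℕ) :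
    Continuous (toricPhi N lam c) := by
  unfold toricPhi
  fun_prop

lemma exp_aux (c u : ℝ) (hc : 0 ≤ c) :
    c * u - Real.exp u ≤ (c + 1) ^ 2 / 2 - max 0 u := by
  rcases le_total u 0 with h | h
  · rw [max_eq_left h]
    have := Real.exp_pos u
    nlinarith [mul_nonneg hc (neg_nonneg.2 h), sq_nonneg (c + 1)]
  · rw [max_eq_right h]
    have := Real.quadratic_le_exp_of_nonneg h
    nlinarith [sq_nonneg (u - (c + 1))]

lemma toricPhi_norm (N : ℕ) (lam : Fin N → ℝ) (c : Fin N → ℕ) (u : Fin N → ℝ) :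
    ‖toricPhi N lam c u‖ = Real.exp (∑ j, ((c j : ℝ) * u j - Real.exp (u j))) := by
  unfold toricPhi
  rw [Complex.norm_exp, Complex.re_sum]
  congr 1
  refine Finset.sum_congr rfl fun j _ => ?_
  rw [Complex.sub_re, Complex.ofReal_re, Complex.re_mul_ofReal]
  simp

lemma integrable_exp_neg_norm (d : ℕ) (δ : ℝ) (hδ : 0 < δ) :
    Integrable (fun s : Fin d → ℝ => Real.exp (-(δ * ‖s‖))) := by
  have h := integrable_one_add_norm (E := Fin d → ℝ) (μ := volume) (r := ((d + 1 : ℕ) : ℝ))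
    (by simp)
  refine (h.const_mul (Real.exp δ * (d + 1).factorial / δ ^ (d + 1))).mono'
    (by fun_prop) (Filter.Eventually.of_forall fun s => ?_)
  have hs : 0 ≤ ‖s‖ := norm_nonneg s
  have h1 := Real.pow_div_factorial_le_exp (x := δ * (1 + ‖s‖)) (by positivity) (d + 1)
  rw [Real.norm_of_nonneg (Real.exp_pos _).le, Real.rpow_neg (by positivity), Real.rpow_natCast,
    Real.exp_neg]
  rw [mul_pow, mul_add, mul_one, Real.exp_add, div_le_iff₀ (by positivity)] at h1
  rw [← div_eq_mul_inv, div_div, ← one_div, div_le_div_iff₀ (by positivity) (by positivity)]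
  nlinarith

lemma toric_coercive (N d : ℕ) (V : (Fin d → ℝ) →ₗ[ℝ] (Fin N → ℝ))
    (hV : ∀ s, (∀ j, V s j ≤ 0) → s = 0) :
    ∃ δ > 0, ∀ s, δ * ‖s‖ ≤ ∑ j, max 0 (V s j) := by
  have hVc : Continuous V := V.continuous_of_finiteDimensional
  have hc : Continuous fun s => ∑ j, max 0 (V s j) := by fun_prop
  obtain ⟨δ, hδ, h⟩ := (isCompact_sphere (0 : Fin d → ℝ) 1).exists_forall_le' (a := (0 : ℝ))
    (f := fun s => ∑ j, max 0 (V s j)) hc.continuousOn (by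
      intro s hs
      by_contra hcon
      have h0 : ∑ j, max 0 (V s j) = 0 :=
        le_antisymm (not_lt.1 hcon) (Finset.sum_nonneg fun _ _ => le_max_left _ _)
      rw [Finset.sum_eq_zero_iff_of_nonneg (fun _ _ => le_max_left _ _)] at h0
      have : s = 0 := hV s fun j => by
        have := h0 j (Finset.mem_univ j)
        exact (le_max_right _ _).trans this.le
      simp [this] at hs)
  refine ⟨δ, hδ, fun s => ?_⟩
  rcases eq_or_ne s 0 with rfl | hs
  · simp
  have hn : 0 < ‖s‖ := norm_pos_iff.2 hs
  have := h (‖s‖⁻¹ • s) (by simp [norm_smul, hn.ne'])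
  have e : ∀ j, max 0 (V (‖s‖⁻¹ • s) j) = ‖s‖⁻¹ * max 0 (V s j) := fun j => by
    rw [mul_max_of_nonneg _ _ (by positivity)]; simp
  simp only [e, ← Finset.mul_sum] at this
  rwa [inv_mul_eq_div, le_div_iff₀ hn] at this

lemma toricPhi_bound (N d : ℕ) (lam : Fin N → ℝ) (V : (Fin d → ℝ) →ₗ[ℝ] (Fin N → ℝ))
    (hV : ∀ s, (∀ j, V s j ≤ 0) → s = 0) (R : ℝ) (c : Fin N → ℕ) :
    ∃ B : (Fin d → ℝ) → ℝ, Integrable B ∧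
      ∀ s, ∀ u : Fin N → ℝ, ‖u‖ ≤ R → ‖toricPhi N lam c (u + V s)‖ ≤ B s := by
  obtain ⟨δ, hδ, h⟩ := toric_coercive N d V hV
  refine ⟨fun s => Real.exp (∑ j, (((c j : ℝ) + 1) ^ 2 / 2 + R)) * Real.exp (-(δ * ‖s‖)),
    (integrable_exp_neg_norm d δ hδ).const_mul _, fun s u hu => ?_⟩
  rw [toricPhi_norm]
  beta_reduce
  rw [← Real.exp_add]
  apply Real.exp_le_exp.2
  have h1 : ∑ j, ((c j : ℝ) * (u + V s) j - Real.exp ((u + V s) j))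
      ≤ ∑ j, ((((c j : ℝ) + 1) ^ 2 / 2 + R) - max 0 (V s j)) := by
    refine Finset.sum_le_sum fun j _ => ?_
    have h2 := exp_aux (c j) ((u + V s) j) (Nat.cast_nonneg _)
    have h3 : |u j| ≤ R := (norm_le_pi_norm u j).trans hu
    have h4 : max 0 (V s j) ≤ max 0 ((u + V s) j) + R := by
      have h5 := abs_le.1 h3
      have h6 := le_max_left 0 ((u + V s) j)
      have h7 := le_max_right 0 ((u + V s) j)
      have h8 : (u + V s) j = u j + V s j := rfl
      apply max_le
      · linarith [abs_nonneg (u j)]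
      · linarith
    linarith
  have h9 : ∑ j, ((((c j : ℝ) + 1) ^ 2 / 2 + R) - max 0 (V s j))
      = ∑ j, (((c j : ℝ) + 1) ^ 2 / 2 + R) - ∑ j, max 0 (V s j) := Finset.sum_sub_distrib _ _
  rw [h9] at h1
  linarith [h s]

lemma toricPhi_integrable (N d : ℕ) (lam : Fin N → ℝ) (V : (Fin d → ℝ) →ₗ[ℝ] (Fin N → ℝ))
    (hV : ∀ s, (∀ j, V s j ≤ 0) → s = 0) (c : Fin N → ℕ) (u : Fin N → ℝ) :
    Integrable fun s => toricPhi N lam c (u + V s) := by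
  have hVc : Continuous V := V.continuous_of_finiteDimensional
  obtain ⟨B, hB, h⟩ := toricPhi_bound N d lam V hV ‖u‖ c
  exact hB.mono' ((toricPhi_continuous N lam c).comp (by fun_prop)).aestronglyMeasurable
    (Filter.Eventually.of_forall fun s => h s u le_rfl)

lemma integrable_sum_aux {E : Type*} [NormedAddCommGroup E] {N d : ℕ}
    (f : Fin N → (Fin d → ℝ) → E) (hf : ∀ j, Integrable (f j)) :
    Integrable (fun s => ∑ j, f j s) :=
  integrable_finsetSum _ fun j _ => hf j

lemma toricD_integral (N d : ℕ) (lam : Fin N → ℝ) (c : Fin N → ℕ)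
    (G : (Fin N → ℕ) → (Fin d → ℝ) → ℂ) (hG : ∀ c', Integrable (G c')) :
    (∫ s, toricD N lam c (fun c' => G c' s)) = toricD N lam c (fun c' => ∫ s, G c' s) := by
  have hi : ∀ j : Fin N, Integrable fun s =>
      ((Complex.I * (lam j : ℂ) + (c j : ℂ)) * G c s - G (c + Pi.single j 1) s) :=
    fun j => ((hG c).const_mul _).sub (hG _)
  have hi' : Integrable fun s => toricD N lam c (fun c' => G c' s) := by
    have h2 : ∀ j : Fin N, Integrable fun s =>
        ContinuousLinearMap.smulRightL ℝ (Fin N → ℝ) ℂ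
        (ContinuousLinearMap.proj (R := ℝ) (φ := fun _ : Fin N => ℝ) j)
        ((Complex.I * (lam j : ℂ) + (c j : ℂ)) * G c s - G (c + Pi.single j 1) s) :=
      fun j => ContinuousLinearMap.integrable_comp _ (hi j)
    have h3 : Integrable (fun s => ∑ j : Fin N,
        ContinuousLinearMap.smulRightL ℝ (Fin N → ℝ) ℂ
        (ContinuousLinearMap.proj (R := ℝ) (φ := fun _ : Fin N => ℝ) j)
        ((Complex.I * (lam j : ℂ) + (c j : ℂ)) * G c s - G (c + Pi.single j 1) s)) :=
      integrable_sum_aux _ h2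
    refine h3.congr (Filter.Eventually.of_forall fun s => ?_)
    refine ContinuousLinearMap.ext fun v => ?_
    simp [toricD_apply]
  refine ContinuousLinearMap.ext fun v => ?_
  rw [ContinuousLinearMap.integral_apply hi']
  simp only [toricD_apply]
  rw [integral_finsetSum _ fun j _ => (hi j).const_mul _]
  refine Finset.sum_congr rfl fun j _ => ?_
  rw [integral_const_mul, integral_sub ((hG c).const_mul _) (hG _), integral_const_mul]

lemma toricJ_hasFDerivAt (N d : ℕ) (lam : Fin N → ℝ) (V : (Fin d → ℝ) →ₗ[ℝ] (Fin N → ℝ))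
    (hV : ∀ s, (∀ j, V s j ≤ 0) → s = 0) (c : Fin N → ℕ) (u : Fin N → ℝ) :
    HasFDerivAt (toricJ N d lam V c) (toricD N lam c (fun c' => toricJ N d lam V c' u)) u := by
  have hVc : Continuous V := V.continuous_of_finiteDimensional
  have hcont : ∀ c u, Continuous fun s => toricPhi N lam c (u + V s) := fun c u =>
    (toricPhi_continuous N lam c).comp (by fun_prop)
  choose B hB h using toricPhi_bound N d lam V hV (‖u‖ + 1)
  have key := hasFDerivAt_integral_of_dominated_of_fderiv_le (𝕜 := ℝ) (μ := volume)
    (F := fun u s => toricPhi N lam c (u + V s))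
    (F' := fun u s => toricD N lam c (fun c' => toricPhi N lam c' (u + V s)))
    (x₀ := u) (s := Metric.ball u 1)
    (bound := fun s => ∑ j : Fin N, (‖Complex.I * (lam j : ℂ) + (c j : ℂ)‖ * B c s
      + B (c + Pi.single j 1) s))
    (Metric.ball_mem_nhds u one_pos)
    (Filter.Eventually.of_forall fun u => (hcont c u).aestronglyMeasurable)
    (toricPhi_integrable N d lam V hV c u)
    (by
      apply Continuous.aestronglyMeasurable
      rw [continuous_clm_apply]
      intro v
      simp only [toricD_apply]
      have := hcont
      fun_prop)
    (Filter.Eventually.of_forall fun s u' hu' => by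
      have hu : ‖u'‖ ≤ ‖u‖ + 1 := by
        have : ‖u' - u‖ < 1 := by simpa [dist_eq_norm] using hu'
        linarith [norm_le_norm_add_norm_sub u u', norm_sub_rev u u']
      unfold toricD
      refine (norm_sum_le _ _).trans (Finset.sum_le_sum fun j _ => ?_)
      rw [ContinuousLinearMap.norm_smulRight_apply]
      have hp : ‖(ContinuousLinearMap.proj (R := ℝ) (φ := fun _ : Fin N => ℝ) j)‖ ≤ 1 :=
        ContinuousLinearMap.opNorm_le_bound _ zero_le_one fun v => by
          simpa using norm_le_pi_norm v j
      refine (mul_le_of_le_one_left (norm_nonneg _) hp).trans ((norm_sub_le _ _).trans ?_)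
      rw [norm_mul]
      gcongr
      · exact h _ _ _ hu
      · exact h _ _ _ hu)
    (integrable_finsetSum _ fun j _ => ((hB c).const_mul _).add (hB _))
    (Filter.Eventually.of_forall fun s u' _ => by
      have := (toricPhi_hasFDerivAt N lam c (u' + V s))
      exact (hasFDerivAt_comp_add_right (V s)).2 this)
  have hint : ∀ c', Integrable (fun s => toricPhi N lam c' (u + V s)) :=
    fun c' => toricPhi_integrable N d lam V hV c' u
  have hval : (∫ s, toricD N lam c (fun c' => toricPhi N lam c' (u + V s)))
      = toricD N lam c (fun c' => toricJ N d lam V c' u) := by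
    exact toricD_integral N d lam c (fun c' s => toricPhi N lam c' (u + V s)) hint
  rw [← hval]
  exact key

lemma toricJ_contDiff (N d : ℕ) (lam : Fin N → ℝ) (V : (Fin d → ℝ) →ₗ[ℝ] (Fin N → ℝ))
    (hV : ∀ s, (∀ j, V s j ≤ 0) → s = 0) (c : Fin N → ℕ) :
    ContDiff ℝ (⊤ : ℕ∞) (toricJ N d lam V c) := by
  rw [contDiff_infty]
  intro k
  induction k generalizing c with
  | zero =>
    rw [Nat.cast_zero, contDiff_zero, continuous_iff_continuousAt]
    exact fun u => (toricJ_hasFDerivAt N d lam V hV c u).continuousAt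
  | succ k ih =>
    rw [Nat.cast_succ, contDiff_succ_iff_fderiv_apply]
    refine ⟨fun u => (toricJ_hasFDerivAt N d lam V hV c u).differentiableAt, by simp, fun v => ?_⟩
    simp only [(toricJ_hasFDerivAt N d lam V hV c _).fderiv, toricD_apply]
    refine ContDiff.sum fun j _ => contDiff_const.mul ((contDiff_const.mul (ih _)).sub (ih _))

lemma toricJ_add_V (N d : ℕ) (lam : Fin N → ℝ) (V : (Fin d → ℝ) →ₗ[ℝ] (Fin N → ℝ))
    (c : Fin N → ℕ) (u : Fin N → ℝ) (w : Fin d → ℝ) :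
    toricJ N d lam V c (u + V w) = toricJ N d lam V c u := by
  unfold toricJ
  rw [← integral_add_left_eq_self (fun s => toricPhi N lam c (u + V s)) w]
  simp only [map_add, add_assoc]

lemma toricJ_fderiv_V (N d : ℕ) (lam : Fin N → ℝ) (V : (Fin d → ℝ) →ₗ[ℝ] (Fin N → ℝ))
    (hV : ∀ s, (∀ j, V s j ≤ 0) → s = 0) (c : Fin N → ℕ) (u : Fin N → ℝ) (w : Fin d → ℝ) :
    toricD N lam c (fun c' => toricJ N d lam V c' u) (V w) = 0 := by
  have h := (toricJ_hasFDerivAt N d lam V hV c u).hasLineDerivAt (V w)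
  have h2 : HasDerivAt (fun t : ℝ => toricJ N d lam V c (u + t • V w)) 0 0 := by
    simp only [← map_smul, toricJ_add_V]
    exact hasDerivAt_const _ _
  exact HasDerivAt.unique h h2

section factors

variable (n N : ℕ) (m : Matrix (Fin n) (Fin N) ℕ) (lam : Fin N → ℝ)

lemma gkzFactor_eq (j : Fin N) (k : ℕ) (f : (Fin n → ℝ) → ℂ) (x : Fin n → ℝ) :
    gkzFactor n N m lam j k f x = (Complex.I * (lam j : ℂ) + (k : ℂ)) * f x
      - fderiv ℝ f x (toricConstraintMap n N m (Pi.single j 1)) := by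
  have : toricConstraintMap n N m (Pi.single j 1)
      = ∑ β : Fin n, (m β j : ℝ) • (Pi.single β 1 : Fin n → ℝ) := by
    ext i
    simp [toricConstraintMap, Pi.single_apply]
  rw [this, map_sum]
  simp [gkzFactor]

lemma gkzFactor_contDiff (j : Fin N) (k : ℕ) (f : (Fin n → ℝ) → ℂ)
    (hf : ContDiff ℝ (⊤ : ℕ∞) f) : ContDiff ℝ (⊤ : ℕ∞) (gkzFactor n N m lam j k f) := by
  have : gkzFactor n N m lam j k f = fun x => (Complex.I * (lam j : ℂ) + (k : ℂ)) * f x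
      - fderiv ℝ f x (toricConstraintMap n N m (Pi.single j 1)) :=
    funext (gkzFactor_eq n N m lam j k f)
  rw [this]
  exact (contDiff_const.mul hf).sub
    ((hf.fderiv_right (m := (⊤ : ℕ∞)) (by simp)).clm_apply contDiff_const)

lemma gkzFactor_comm (j j' : Fin N) (k k' : ℕ) (f : (Fin n → ℝ) → ℂ)
    (hf : ContDiff ℝ (⊤ : ℕ∞) f) :
    gkzFactor n N m lam j k (gkzFactor n N m lam j' k' f)
      = gkzFactor n N m lam j' k' (gkzFactor n N m lam j k f) := by
  have hd : Differentiable ℝ f := hf.differentiable (by simp)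
  have hf' : ContDiff ℝ (⊤ : ℕ∞) (fderiv ℝ f) := hf.fderiv_right (by simp)
  have hd' : Differentiable ℝ (fderiv ℝ f) := hf'.differentiable (by simp)
  have hfd : ∀ (a : ℂ) (v w x : Fin n → ℝ),
      fderiv ℝ (fun x => a * f x - fderiv ℝ f x v) x w
        = a * fderiv ℝ f x w - fderiv ℝ (fderiv ℝ f) x w v := by
    intro a v w x
    have h1 : HasFDerivAt (fun x => a * f x - fderiv ℝ f x v)
        (a • fderiv ℝ f x - (fderiv ℝ (fderiv ℝ f) x).flip v) x := by
      refine ((hd x).hasFDerivAt.const_mul a).sub ?_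
      have := (hd' x).hasFDerivAt.clm_apply (hasFDerivAt_const v x)
      simpa using this
    rw [h1.fderiv]
    simp
  have hsymm : ∀ x v w, fderiv ℝ (fderiv ℝ f) x v w = fderiv ℝ (fderiv ℝ f) x w v := by
    intro x v w
    exact (hf.contDiffAt.isSymmSndFDerivAt (by
      simp only [minSmoothness_of_isRCLikeNormedField]
      exact WithTop.coe_le_coe.2 le_top)) v w
  have hfun : ∀ (j : Fin N) (k : ℕ), gkzFactor n N m lam j k f
      = fun x => (Complex.I * (lam j : ℂ) + (k : ℂ)) * f x
      - fderiv ℝ f x (toricConstraintMap n N m (Pi.single j 1)) :=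
    fun j k => funext (gkzFactor_eq n N m lam j k f)
  ext x
  have hh : ∀ (j j' : Fin N) (k k' : ℕ),
      gkzFactor n N m lam j k (gkzFactor n N m lam j' k' f) x
      = (Complex.I * (lam j : ℂ) + (k : ℂ)) * ((Complex.I * (lam j' : ℂ) + (k' : ℂ)) * f x
        - fderiv ℝ f x (toricConstraintMap n N m (Pi.single j' 1)))
        - ((Complex.I * (lam j' : ℂ) + (k' : ℂ))
            * fderiv ℝ f x (toricConstraintMap n N m (Pi.single j 1))
          - fderiv ℝ (fderiv ℝ f) x (toricConstraintMap n N m (Pi.single j 1))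
            (toricConstraintMap n N m (Pi.single j' 1))) := by
    intro j j' k k'
    rw [gkzFactor_eq, hfun j' k', hfd]
  rw [hh, hh, hsymm]
  ring

/-- composition of a list of factors -/
noncomputable def gkzList (L : List (((Fin n → ℝ) → ℂ) → ((Fin n → ℝ) → ℂ))) :
    ((Fin n → ℝ) → ℂ) → ((Fin n → ℝ) → ℂ) := L.foldr (· ∘ ·) id

lemma gkzList_append (L L' : List (((Fin n → ℝ) → ℂ) → ((Fin n → ℝ) → ℂ)))
    (f : (Fin n → ℝ) → ℂ) : gkzList n (L ++ L') f = gkzList n L (gkzList n L' f) := by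
  induction L with
  | nil => rfl
  | cons a L ih =>
    change a (gkzList n (L ++ L') f) = a (gkzList n L (gkzList n L' f))
    rw [ih]

lemma gkzList_comm (j : Fin N) (a k : ℕ) (f : (Fin n → ℝ) → ℂ)
    (hf : ContDiff ℝ (⊤ : ℕ∞) f) :
    ContDiff ℝ (⊤ : ℕ∞)
      (gkzList n (List.ofFn fun k : Fin a => gkzFactor n N m lam j (k : ℕ)) f) ∧
    gkzList n (List.ofFn fun k : Fin a => gkzFactor n N m lam j (k : ℕ))
      (gkzFactor n N m lam j k f)
      = gkzFactor n N m lam j k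
        (gkzList n (List.ofFn fun k : Fin a => gkzFactor n N m lam j (k : ℕ)) f) := by
  induction a generalizing f k with
  | zero => exact ⟨by simpa [gkzList] using hf, by simp [gkzList]⟩
  | succ a ih =>
    have e : ∀ g, gkzList n (List.ofFn fun k : Fin (a + 1) => gkzFactor n N m lam j (k : ℕ)) g
        = gkzList n (List.ofFn fun k : Fin a => gkzFactor n N m lam j (k : ℕ))
          (gkzFactor n N m lam j a g) := by
      intro g
      rw [List.ofFn_succ_last, gkzList_append]
      rfl
    rw [e, e]
    have hc := gkzFactor_contDiff n N m lam j a f hf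
    refine ⟨(ih 0 _ hc).1, ?_⟩
    rw [gkzFactor_comm _ _ _ _ _ _ _ _ _ hf, (ih k _ hc).2]

variable (d : ℕ) (u0 : (Fin n → ℝ) →ₗ[ℝ] (Fin N → ℝ)) (V : (Fin d → ℝ) →ₗ[ℝ] (Fin N → ℝ))

/-- shifted periods -/
noncomputable def toricI (c : Fin N → ℕ) (x : Fin n → ℝ) : ℂ := toricJ N d lam V c (u0 x)

lemma toricI_contDiff
    (hV : ∀ s, (∀ j, V s j ≤ 0) → s = 0)
    (c : Fin N → ℕ) : ContDiff ℝ (⊤ : ℕ∞) (toricI n N lam d u0 V c) :=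
  (toricJ_contDiff N d lam V hV c).comp (LinearMap.toContinuousLinearMap u0).contDiff

lemma toricI_factor
    (hu0 : ∀ x, toricConstraintMap n N m (u0 x) = x)
    (hVrange : LinearMap.range V = LinearMap.ker (toricConstraintMap n N m))
    (hV : ∀ s, (∀ j, V s j ≤ 0) → s = 0)
    (c : Fin N → ℕ) (j : Fin N) (k : ℕ) (hk : c j = k) :
    gkzFactor n N m lam j k (toricI n N lam d u0 V c)
      = toricI n N lam d u0 V (c + Pi.single j 1) := by
  ext x
  rw [gkzFactor_eq]
  have h1 : HasFDerivAt (toricI n N lam d u0 V c)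
      ((toricD N lam c (fun c' => toricJ N d lam V c' (u0 x))).comp
        (LinearMap.toContinuousLinearMap u0)) x :=
    HasFDerivAt.comp (g := toricJ N d lam V c) x (toricJ_hasFDerivAt N d lam V hV c (u0 x))
      (LinearMap.toContinuousLinearMap u0).hasFDerivAt
  rw [h1.fderiv]
  obtain ⟨w, hw⟩ : ∃ w, V w
      = u0 (toricConstraintMap n N m (Pi.single j 1)) - Pi.single j 1 := by
    rw [← LinearMap.mem_range, hVrange, LinearMap.mem_ker, map_sub, hu0, sub_self]
  have h2 : u0 (toricConstraintMap n N m (Pi.single j 1)) = Pi.single j 1 + V w := by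
    rw [hw]; abel
  rw [ContinuousLinearMap.comp_apply, LinearMap.coe_toContinuousLinearMap', h2, map_add,
    toricJ_fderiv_V N d lam V hV, toricD_apply, Finset.sum_eq_single j]
  · simp [toricI, hk]
  · intro b _ hb
    simp [Pi.single_eq_of_ne hb]
  · simp

lemma toricI_inner
    (hu0 : ∀ x, toricConstraintMap n N m (u0 x) = x)
    (hVrange : LinearMap.range V = LinearMap.ker (toricConstraintMap n N m))
    (hV : ∀ s, (∀ j, V s j ≤ 0) → s = 0)
    (c : Fin N → ℕ) (j : Fin N) (hc : c j = 0) (a : ℕ) :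
    gkzList n (List.ofFn fun k : Fin a => gkzFactor n N m lam j (k : ℕ))
      (toricI n N lam d u0 V c) = toricI n N lam d u0 V (c + Pi.single j a) := by
  induction a with
  | zero => simp [gkzList]
  | succ a ih =>
    rw [List.ofFn_succ_last, gkzList_append]
    change gkzList n (List.ofFn fun k : Fin a => gkzFactor n N m lam j (k : ℕ))
      (gkzFactor n N m lam j a (toricI n N lam d u0 V c)) = _
    rw [(gkzList_comm n N m lam j a a _ (toricI_contDiff n N lam d u0 V hV c)).2, ih,
      toricI_factor n N m lam d u0 V hu0 hVrange hV _ j a (by simp [hc]), add_assoc,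
      ← Pi.single_add]

lemma toricI_outer
    (hu0 : ∀ x, toricConstraintMap n N m (u0 x) = x)
    (hVrange : LinearMap.range V = LinearMap.ker (toricConstraintMap n N m))
    (hV : ∀ s, (∀ j, V s j ≤ 0) → s = 0)
    (α : Fin n) (L : List (Fin N)) (hL : L.Nodup) :
    gkzList n ((L.map fun j =>
      (List.ofFn fun k : Fin (m α j) => gkzFactor n N m lam j (k : ℕ))).flatten)
      (toricI n N lam d u0 V 0)
      = toricI n N lam d u0 V (fun j => if j ∈ L then m α j else 0) := by
  induction L with
  | nil => simp [gkzList]; rfl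
  | cons j L ih =>
    rw [List.nodup_cons] at hL
    rw [List.map_cons, List.flatten_cons, gkzList_append, ih hL.2,
      toricI_inner n N m lam d u0 V hu0 hVrange hV _ j (by simp [hL.1])]
    congr 1
    ext i
    by_cases h : i = j
    · subst h
      simp [hL.1]
    · simp [h]

end factors

/-- In the general toric setup, the mirror period `Ψ` is a smooth function on
`ℝ^n` and satisfies, for every `α` and every `x`, the generalized hypergeometric
(GKZ-type) differential equation
`(∏_{j=1}^N ∏_{k=0}^{m_j^α-1} (iλ_j + k - ∑_β m_j^β ∂_{x^β})) Ψ(x) = e^{x^α} Ψ(x)`. -/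
theorem toricPeriod_gkz_equation (n N : ℕ) (hn : 1 ≤ n) (hnN : n ≤ N)
    (m : Matrix (Fin n) (Fin N) ℕ) (lam : Fin N → ℝ)
    (hrank : Function.Surjective (toricConstraintMap n N m))
    (hker : ∀ v : Fin N → ℝ, toricConstraintMap n N m v = 0 → (∀ j, v j ≤ 0) → v = 0)
    (u0 : (Fin n → ℝ) →ₗ[ℝ] (Fin N → ℝ))
    (hu0 : ∀ x, toricConstraintMap n N m (u0 x) = x)
    (V : (Fin (N - n) → ℝ) →ₗ[ℝ] (Fin N → ℝ))
    (hVinj : Function.Injective V)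
    (hVrange : LinearMap.range V = LinearMap.ker (toricConstraintMap n N m)) :
    ContDiff ℝ (⊤ : ℕ∞) (toricPeriod n N lam u0 V) ∧
    ∀ α : Fin n, ∀ x : Fin n → ℝ,
      gkzOp n N m lam α (toricPeriod n N lam u0 V) x
        = Real.exp (x α) * toricPeriod n N lam u0 V x := by
  have hV : ∀ s, (∀ j, V s j ≤ 0) → s = 0 := by
    intro s hs
    apply hVinj
    rw [map_zero]
    refine hker _ ?_ hs
    rw [← LinearMap.mem_ker, ← hVrange]
    exact LinearMap.mem_range_self V s
  have h0 : toricPeriod n N lam u0 V = toricI n N lam (N - n) u0 V 0 := by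
    ext x
    simp [toricPeriod, toricI, toricJ, toricPhi]
  rw [h0]
  refine ⟨toricI_contDiff n N lam _ u0 V hV 0, fun α x => ?_⟩
  have h1 := toricI_outer n N m lam _ u0 V hu0 hVrange hV α (List.finRange N)
    (List.nodup_finRange N)
  have h2 : gkzOp n N m lam α (toricI n N lam (N - n) u0 V 0)
      = toricI n N lam (N - n) u0 V (m α) := by
    unfold gkzOp
    rw [List.ofFn_eq_map]
    simpa [gkzList] using h1
  rw [h2]
  unfold toricI toricJ
  rw [← integral_const_mul]
  congr 1
  ext s
  unfold toricPhi
  rw [Complex.ofReal_exp, ← Complex.exp_add]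
  congr 1
  have h3 : toricConstraintMap n N m (u0 x + V s) = x := by
    have : V s ∈ LinearMap.ker (toricConstraintMap n N m) := by
      rw [← hVrange]; exact LinearMap.mem_range_self V s
    rw [map_add, hu0, LinearMap.mem_ker.1 this, add_zero]
  have h4 : (x α : ℂ) = ∑ j, (m α j : ℂ) * ((u0 x + V s) j : ℂ) := by
    have h5 : x α = ∑ j, (m α j : ℝ) * (u0 x + V s) j := by
      conv_lhs => rw [← h3]
      simp [toricConstraintMap, Matrix.mulVec, dotProduct]
    rw [h5]
    push_cast
    rfl
  rw [h4, ← Finset.sum_add_distrib]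
  refine Finset.sum_congr rfl fun j _ => ?_
  simp only [Pi.zero_apply]
  push_cast
  ring
end
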